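/- For every integer N ≥ 2 and every x with 0 < x < 1, the functions F_N satisfy the recurrence F_{N+2}(x) = ((N+1)/(N−1)²) · ((2N−3) F_{N+1}(x) − (1−x) N F_N(x)). -/

import Mathlib

open MeasureTheory

/-- The Gauss hypergeometric series `H(a,b;c;t) = ∑_j ((a)_j (b)_j / ((c)_j j!)) t^j`. -/
noncomputable def GaussH (a b c t : ℝ) : ℝ :=
  ∑' j : ℕ, ((ascPochhammer ℝ j).eval a * (ascPochhammer ℝ j).eval b /
      ((ascPochhammer ℝ j).eval c * (j.factorial : ℝ))) * t ^ j

/-- The function `F_N`, defined by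
`F_N(x) = (Γ(N/2)Γ((N+1)/2)/Γ(N−3/2)) (1−x)^{N−5/2} H((N−1)/2,(N−2)/2;N−3/2;1−x)`
for `x < 1` and `F_N(x) = 0` for `x ≥ 1`. -/
noncomputable def Fdens (N : ℕ) (x : ℝ) : ℝ :=
  if x < 1 then
    (Real.Gamma ((N : ℝ) / 2) * Real.Gamma (((N : ℝ) + 1) / 2) /
        Real.Gamma ((N : ℝ) - 3 / 2)) *
      (1 - x) ^ ((N : ℝ) - 5 / 2) *
      GaussH (((N : ℝ) - 1) / 2) (((N : ℝ) - 2) / 2) ((N : ℝ) - 3 / 2) (1 - x)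
  else 0

/-- The `j`-th coefficient of the Gauss hypergeometric series. -/
noncomputable def gaussCoeff (a b c : ℝ) (j : ℕ) : ℝ :=
  (ascPochhammer ℝ j).eval a * (ascPochhammer ℝ j).eval b /
    ((ascPochhammer ℝ j).eval c * (j.factorial : ℝ))

theorem GaussH_eq_tsum (a b c t : ℝ) : GaussH a b c t = ∑' j : ℕ, gaussCoeff a b c j * t ^ j :=
  rfl

theorem GaussH_comm (a b c t : ℝ) : GaussH a b c t = GaussH b a c t := by
  simp only [GaussH, mul_comm ((ascPochhammer ℝ _).eval a)]

theorem ascPochhammer_eval_succ_left (a : ℝ) (j : ℕ) :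
    (ascPochhammer ℝ (j + 1)).eval a = a * (ascPochhammer ℝ j).eval (a + 1) := by
  simp [ascPochhammer_succ_left, Polynomial.eval_comp]

theorem gaussCoeff_zero (a b c : ℝ) : gaussCoeff a b c 0 = 1 := by
  simp [gaussCoeff]

theorem gaussCoeff_succ (a b c : ℝ) (j : ℕ) :
    gaussCoeff a b c (j + 1) =
      (a + j) / (j + 1) * ((b + j) / (c + j)) * gaussCoeff a b c j := by
  simp only [gaussCoeff, ascPochhammer_succ_eval, Nat.factorial_succ, Nat.cast_mul, Nat.cast_succ,
    div_eq_mul_inv, mul_inv]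
  ring

theorem tendsto_add_natCast_div_add_natCast (a b : ℝ) :
    Filter.Tendsto (fun n : ℕ => (a + n) / (b + n)) Filter.atTop (nhds 1) := by
  simpa using tendsto_add_mul_div_add_mul_atTop_nhds a b (1 : ℝ) (one_ne_zero)

theorem summable_gaussCoeff_mul_pow (a b c : ℝ) {t : ℝ} (ht : |t| < 1) :
    Summable fun j : ℕ => gaussCoeff a b c j * t ^ j := by
  obtain ⟨r, htr, hr⟩ := exists_between ht
  have hlim : Filter.Tendsto
      (fun n : ℕ => |(a + n) / (1 + n) * ((b + n) / (c + n)) * t|) Filter.atTop (nhds |t|) := by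
    simpa using (((tendsto_add_natCast_div_add_natCast a 1).mul
      (tendsto_add_natCast_div_add_natCast b c)).mul_const t).abs
  refine summable_of_ratio_norm_eventually_le hr ?_
  filter_upwards [hlim.eventually_le_const htr] with n hn
  have h : gaussCoeff a b c (n + 1) * t ^ (n + 1) =
      ((a + n) / (1 + n) * ((b + n) / (c + n)) * t) * (gaussCoeff a b c n * t ^ n) := by
    rw [gaussCoeff_succ, add_comm (n : ℝ) 1]
    ring
  rw [h, norm_mul]
  exact mul_le_mul_of_nonneg_right hn (norm_nonneg _)

theorem gaussCoeff_succ_contiguous (a b : ℝ) {c : ℝ} (hc : 0 < c) (j : ℕ) :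
    gaussCoeff a (b + 1) (c + 1) (j + 1) - gaussCoeff a b c (j + 1) =
      a * (c - b) / (c * (c + 1)) * gaussCoeff (a + 1) (b + 1) (c + 2) j := by
  have hP : 0 < (ascPochhammer ℝ j).eval (c + 2) := ascPochhammer_pos j _ (by linarith)
  have hQ : 0 < (ascPochhammer ℝ j).eval (c + 1) := ascPochhammer_pos j _ (by linarith)
  have hf : (0 : ℝ) < j.factorial := by exact_mod_cast j.factorial_pos
  have hj : (0 : ℝ) < c + 1 + j := by positivity
  have key : (c + 1) * (ascPochhammer ℝ j).eval (c + 2) =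
      (ascPochhammer ℝ j).eval (c + 1) * (c + 1 + j) := by
    rw [← ascPochhammer_succ_eval, ascPochhammer_eval_succ_left]
    norm_num [add_assoc]
  have hP' : (ascPochhammer ℝ j).eval (c + 2) =
      (ascPochhammer ℝ j).eval (c + 1) * (c + 1 + j) / (c + 1) := by
    rw [← key]; field_simp
  simp only [gaussCoeff, Nat.factorial_succ, Nat.cast_mul, Nat.cast_succ]
  rw [ascPochhammer_eval_succ_left a, ascPochhammer_eval_succ_left b,
    ascPochhammer_eval_succ_left c, ascPochhammer_succ_eval j (b + 1),
    ascPochhammer_succ_eval j (c + 1), hP']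
  field_simp
  ring

/-- Gauss's contiguous relation
`H(a,b+1;c+1;t) − H(a,b;c;t) = (a(c−b)/(c(c+1))) t H(a+1,b+1;c+2;t)`. -/
theorem GaussH_contiguous (a b : ℝ) {c t : ℝ} (hc : 0 < c) (ht : |t| < 1) :
    GaussH a (b + 1) (c + 1) t - GaussH a b c t =
      a * (c - b) / (c * (c + 1)) * (t * GaussH (a + 1) (b + 1) (c + 2) t) := by
  have h₁ := summable_gaussCoeff_mul_pow a (b + 1) (c + 1) ht
  have h₂ := summable_gaussCoeff_mul_pow a b c ht
  simp only [GaussH_eq_tsum]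
  rw [← h₁.tsum_sub h₂, (h₁.sub h₂).tsum_eq_zero_add, ← tsum_mul_left, ← tsum_mul_left]
  simp only [gaussCoeff_zero, sub_self, zero_add]
  refine tsum_congr fun j => ?_
  rw [← sub_mul, gaussCoeff_succ_contiguous a b hc]
  ring

/-- The recurrence of the Gamma-function prefactor of `Fdens`. -/
theorem gamma_prefactor_add_one {s : ℝ} (hs : 3 / 2 < s) :
    Real.Gamma ((s + 1) / 2) * Real.Gamma ((s + 1 + 1) / 2) / Real.Gamma (s + 1 - 3 / 2) =
      s / (2 * s - 3) *
        (Real.Gamma (s / 2) * Real.Gamma ((s + 1) / 2) / Real.Gamma (s - 3 / 2)) := by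
  have h₁ : Real.Gamma ((s + 1 + 1) / 2) = s / 2 * Real.Gamma (s / 2) := by
    rw [← Real.Gamma_add_one (by linarith)]; ring_nf
  have h₂ : Real.Gamma (s + 1 - 3 / 2) = (s - 3 / 2) * Real.Gamma (s - 3 / 2) := by
    rw [← Real.Gamma_add_one (by linarith)]; ring_nf
  have h₃ : Real.Gamma (s - 3 / 2) ≠ 0 := (Real.Gamma_pos_of_pos (by linarith)).ne'
  have h₄ : s - 3 / 2 ≠ 0 := by linarith
  have h₅ : 2 * s - 3 ≠ 0 := by linarith
  rw [h₁, h₂, show s - 3 / 2 = (2 * s - 3) / 2 by ring] at *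
  field_simp

/-- Recurrence for the functions `F_N`:
`F_{N+2}(x) = ((N+1)/(N−1)²)((2N−3)F_{N+1}(x) − (1−x)N F_N(x))` for `0 < x < 1`. -/
theorem stmt_11 (N : ℕ) (hN : 2 ≤ N) (x : ℝ) (hx0 : 0 < x) (hx1 : x < 1) :
    Fdens (N + 2) x
      = (((N : ℝ) + 1) / ((N : ℝ) - 1) ^ 2) *
          ((2 * (N : ℝ) - 3) * Fdens (N + 1) x - (1 - x) * (N : ℝ) * Fdens N x) := by
  have hs : (2 : ℝ) ≤ N := by exact_mod_cast hN
  simp only [Fdens, if_pos hx1, Nat.cast_add, Nat.cast_one, Nat.cast_ofNat]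
  generalize (N : ℝ) = s at hs ⊢
  have ht0 : 0 < 1 - x := by linarith
  have ht1 : |1 - x| < 1 := by rw [abs_of_pos ht0]; linarith
  generalize 1 - x = t at ht0 ht1 ⊢
  have hG₁ := gamma_prefactor_add_one (s := s) (by linarith)
  have hG₂ := gamma_prefactor_add_one (s := s + 1) (by linarith)
  have hp₁ : t ^ (s + 1 - 5 / 2) = t ^ (s - 5 / 2) * t := by
    rw [← Real.rpow_add_one ht0.ne']; ring_nf
  have hp₂ : t ^ (s + 2 - 5 / 2) = t ^ (s - 5 / 2) * t * t := by
    rw [← Real.rpow_add_one ht0.ne', ← Real.rpow_add_one ht0.ne']; ring_nf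
  have hH := GaussH_contiguous ((s - 1) / 2) ((s - 2) / 2) (c := s - 3 / 2) (by linarith) ht1
  rw [GaussH_comm ((s - 1) / 2) ((s - 2) / 2 + 1),
    show (s - 2) / 2 + 1 = (s + 1 - 1) / 2 by ring,
    show (s - 1) / 2 + 1 = (s + 2 - 1) / 2 by ring,
    show (s + 1 - 1) / 2 = (s + 2 - 2) / 2 by ring,
    show s - 3 / 2 + 1 = s + 1 - 3 / 2 by ring,
    show s - 3 / 2 + 2 = s + 2 - 3 / 2 by ring, sub_eq_iff_eq_add] at hH
  rw [show s + 1 + 1 = s + 2 by ring] at hG₁ hG₂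
  rw [show s + 1 + 1 = s + 2 by ring, hG₂, hG₁, hp₁, hp₂,
    show (s + 1 - 1) / 2 = (s + 2 - 2) / 2 by ring,
    show (s + 1 - 2) / 2 = (s - 1) / 2 by ring, hH,
    show s + 1 - 3 / 2 = (2 * s - 1) / 2 by ring]
  have h₁ : s - 1 ≠ 0 := by linarith
  have h₂ : s * 2 - 3 ≠ 0 := by linarith
  have h₃ : s * 2 - 1 ≠ 0 := by linarith
  generalize GaussH ((s + 2 - 1) / 2) ((s + 2 - 2) / 2) (s + 2 - 3 / 2) t = H₂
  generalize GaussH ((s - 1) / 2) ((s - 2) / 2) (s - 3 / 2) t = H₀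
  generalize Real.Gamma (s / 2) * Real.Gamma ((s + 1) / 2) / Real.Gamma (s - 3 / 2) = G
  generalize t ^ (s - 5 / 2) = p
  rw [show s - 3 / 2 - (s - 2) / 2 = (s - 1) / 2 by ring,
    show s - 3 / 2 = (2 * s - 3) / 2 by ring, show 2 * (s + 1) - 3 = 2 * s - 1 by ring]
  field_simp
  ring
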